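/- Tail probability / survival formula for a UGAT coordinate: if (X_1,...,X_r) has the UGAT distribution, then for each coordinate i and each x ∈ ℕ, P(X_i > x) = α_{i-1}^{x+1} · M(β+x+1, s, α) / M(β, s, α). -/

import Mathlib

open scoped BigOperators

/-- Normalization constant of the UGAT distribution. -/
noncomputable def M (r : ℕ) (β s : ℝ) (α : Fin r → ℝ) : ℝ :=
  ∑' ℓ : Fin r → ℕ, (∏ i, α i ^ ℓ i) / ((∑ i, (ℓ i : ℝ)) + β) ^ s

/-- The UGAT joint probability mass function. -/
noncomputable def ugatPmf (r : ℕ) (β s : ℝ) (α : Fin r → ℝ) (x : Fin r → ℕ) : ℝ :=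
  (∏ i, α i ^ x i) / (((∑ i, (x i : ℝ)) + β) ^ s * M r β s α)

theorem ugat_tail_prob (r : ℕ) (hr : 1 ≤ r) (β s : ℝ) (hβ : 0 < β) (hs : 0 < s)
    (α : Fin r → ℝ) (hα : ∀ i, α i ∈ Set.Ioo (0 : ℝ) 1) (i : Fin r) (x : ℕ) :
    (∑' m : {m : Fin r → ℕ // x < m i}, ugatPmf r β s α m)
      = α i ^ (x + 1) * M r (β + x + 1) s α / M r β s α := by
  let e : (Fin r → ℕ) ≃ {m : Fin r → ℕ // x < m i} :=
    { toFun := fun l => ⟨l + Pi.single i (x + 1), by simp; omega⟩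
      invFun := fun m => m.1 - Pi.single i (x + 1)
      left_inv := fun l => by simp
      right_inv := fun m => by
        apply Subtype.ext
        funext j
        have hm := m.2
        by_cases h : j = i
        · subst h
          simp
          omega
        · simp [h] }
  rw [← e.tsum_eq, mul_div_right_comm, M.eq_def r (β + x + 1), ← tsum_mul_left]
  refine tsum_congr fun l => ?_
  have hp : ∏ j, α j ^ (l + Pi.single i (x + 1) : Fin r → ℕ) j = (∏ j, α j ^ l j) * α i ^ (x + 1) := by
    simp only [Pi.add_apply, pow_add, Finset.prod_mul_distrib]
    congr 1
    rw [Finset.prod_eq_single i]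
    · simp [pow_succ]
    · intro j _ hj
      simp [hj]
    · simp
  have hsum : ∑ j, (((l + Pi.single i (x + 1) : Fin r → ℕ) j : ℕ) : ℝ) = (∑ j, (l j : ℝ)) + (x + 1) := by
    simp only [Pi.add_apply, Nat.cast_add, Finset.sum_add_distrib]
    congr 1
    rw [Finset.sum_eq_single i]
    · simp
    · intro j _ hj
      simp [hj]
    · simp
  change ugatPmf r β s α (l + Pi.single i (x + 1)) = _
  rw [ugatPmf, hp, hsum,
    show (∑ j, (l j : ℝ)) + (x + 1) + β = (∑ j, (l j : ℝ)) + (β + x + 1) by ring]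
  simp only [div_eq_mul_inv, mul_inv]
  ring
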